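/- Γ₀(1) = 0. -/

import Mathlib

open MeasureTheory

/-- The cubic NLS soliton profile. -/
noncomputable def Q (y : ℝ) : ℝ := Real.sqrt 2 / Real.cosh y

/-- The explicit odd-growth solution of the linearized equation. -/
noncomputable def A (y : ℝ) : ℝ :=
  (Real.sqrt 2 / (4 * Real.cosh y)) * (3 * y * Real.tanh y + (Real.sinh y) ^ 2 - 2)

noncomputable def T1 (σ : ℝ) (y : ℝ) : ℝ :=
  -((σ - 1) ^ 2 / (2 * (σ + 1))) * ∫ z : ℝ, |y - z| * Q z ^ (2 * σ)

noncomputable def T2 (σ : ℝ) (y : ℝ) : ℝ :=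
  -(Real.sqrt 2 * σ * (σ - 1) / (4 * (σ + 1))) *
    ∫ z : ℝ, Real.exp (-(Real.sqrt 2) * |y - z|) * Q z ^ (2 * σ)

noncomputable def D0 (σ : ℝ) (y : ℝ) : ℝ :=
  -(deriv Q y) * (∫ z in (0:ℝ)..y, A z * Q z ^ (2 * σ + 1))
    + A y * Q y ^ (2 * σ + 2) / (2 * σ + 2)

noncomputable def Delta4 (σ : ℝ) (y : ℝ) : ℝ :=
  (13 * Q y ^ 2 - 16) * Q y ^ 2 * D0 σ y
    - 8 * deriv Q y * Q y * deriv (D0 σ) y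
    + 2 * Q y * (3 * (1 - Q y ^ 2) ^ 2 - 1) * T1 σ y
    + 6 * Q y * (2 - Q y ^ 2) ^ 2 * T2 σ y
    + 4 * (2 - 3 * Q y ^ 2) * deriv Q y * deriv (T1 σ) y
    + 4 * (4 - 3 * Q y ^ 2) * deriv Q y * deriv (T2 σ) y
    + 2 * σ ^ 2 * Q y ^ (2 * σ - 1)
    - (4 * (σ + 2) / (σ + 1) + (2 * σ + 1) ^ 2) * Q y ^ (2 * σ + 1)
    + (8 / (σ + 1) + (σ + 1) * (2 * σ + 1)) * Q y ^ (2 * σ + 3)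

noncomputable def Delta5 (σ : ℝ) (y : ℝ) : ℝ :=
  (2 - 30 * Q y ^ 2 + 29 * Q y ^ 4 - 8 * Q y ^ 6) * D0 σ y
    - 8 * Q y ^ 3 * deriv Q y * deriv (D0 σ) y
    + 2 * Q y * (2 - Q y ^ 2) * (2 - 3 * Q y ^ 2) * T1 σ y
    + 2 * Q y * (3 * Q y ^ 4 - 10 * Q y ^ 2 + 12) * T2 σ y
    + 16 * (1 - Q y ^ 2) * deriv Q y * deriv (T1 σ) y
    + 8 * (2 - Q y ^ 2) * deriv Q y * deriv (T2 σ) y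
    + 2 * σ * (σ + 1) * Q y ^ (2 * σ - 1)
    - (16 / (σ + 1) + 2 * σ + (2 * σ + 1) ^ 2) * Q y ^ (2 * σ + 1)
    + (4 * (4 - σ) / (σ + 1) + (σ + 1) * (2 * σ + 1)) * Q y ^ (2 * σ + 3)
    - (4 / (σ + 1)) * Q y ^ (2 * σ + 5)

noncomputable def Gamma0 (σ : ℝ) : ℝ :=
  ∫ y : ℝ, (Q y ^ 2 * Delta4 σ y * Real.cos y
    + (2 * deriv Q y / Q y) * Delta5 σ y * Real.sin y)

/-- `Q` is differentiable, with an explicit derivative. -/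
theorem hasDerivAt_Q (y : ℝ) :
    HasDerivAt Q (-(Real.sqrt 2 * Real.sinh y / Real.cosh y ^ 2)) y := by
  have h : HasDerivAt Q _ y :=
    (hasDerivAt_const y (Real.sqrt 2)).div (Real.hasDerivAt_cosh y) (Real.cosh_pos y).ne'
  refine h.congr_deriv ?_
  ring

theorem deriv_Q (y : ℝ) : deriv Q y = -(Real.sqrt 2 * Real.sinh y / Real.cosh y ^ 2) :=
  (hasDerivAt_Q y).deriv

theorem Q_pos (y : ℝ) : 0 < Q y :=
  div_pos (by positivity) (Real.cosh_pos y)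

theorem Q_le (y : ℝ) : Q y ≤ Real.sqrt 2 :=
  div_le_self (by positivity) (Real.one_le_cosh y)

/-- First integral of the soliton equation. -/
theorem deriv_Q_sq (y : ℝ) : deriv Q y ^ 2 = Q y ^ 2 - Q y ^ 4 / 2 := by
  have hc := (Real.cosh_pos y).ne'
  have h2 : Real.sqrt 2 ^ 2 = 2 := Real.sq_sqrt (by norm_num)
  have h4 : Real.sqrt 2 ^ 4 = 4 := by rw [show 4 = 2 * 2 from rfl, pow_mul, h2]; norm_num
  rw [deriv_Q, Q, neg_sq, div_pow, div_pow, div_pow, mul_pow, h2, h4, Real.sinh_sq]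
  field_simp
  ring

/-- The soliton equation. -/
theorem hasDerivAt_deriv_Q (y : ℝ) : HasDerivAt (deriv Q) (Q y - Q y ^ 3) y := by
  have hc := (Real.cosh_pos y).ne'
  have h2 : Real.sqrt 2 ^ 2 = 2 := Real.sq_sqrt (by norm_num)
  rw [funext deriv_Q]
  have h := (((Real.hasDerivAt_sinh y).const_mul (Real.sqrt 2)).div
    ((Real.hasDerivAt_cosh y).pow 2) (pow_ne_zero 2 hc)).neg
  refine h.congr_deriv ?_
  have h3 : Real.sqrt 2 ^ 3 = 2 * Real.sqrt 2 := by rw [pow_succ, h2]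
  simp only [Q, div_pow, h3, Pi.pow_apply]
  field_simp
  push_cast
  linear_combination 2 * Real.cosh y * Real.sinh_sq y

theorem continuous_Q : Continuous Q :=
  continuous_iff_continuousAt.2 fun y => (hasDerivAt_Q y).continuousAt

theorem integral_A_mul_Q_cube (y : ℝ) :
    ∫ z in (0 : ℝ)..y, A z * Q z ^ 3 =
      -(3 / 4) * y / Real.cosh y ^ 4 - 5 / 4 * (Real.sinh y / Real.cosh y)
        + 3 / 4 * (Real.sinh y / Real.cosh y) ^ 3 := by
  have hA : Continuous A := by
    unfold A
    simp only [Real.tanh_eq_sinh_div_cosh]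
    fun_prop (disch := intro x; have := Real.cosh_pos x; positivity)
  rw [intervalIntegral.integral_eq_sub_of_hasDerivAt (f := fun y =>
      -(3 / 4) * y / Real.cosh y ^ 4 - 5 / 4 * (Real.sinh y / Real.cosh y)
        + 3 / 4 * (Real.sinh y / Real.cosh y) ^ 3)]
  · simp
  · intro x _
    have hc := (Real.cosh_pos x).ne'
    have ht := (Real.hasDerivAt_sinh x).div (Real.hasDerivAt_cosh x) hc
    have h := (((hasDerivAt_id x).const_mul (-(3 / 4) : ℝ)).div
      ((Real.hasDerivAt_cosh x).pow 4) (pow_ne_zero 4 hc)).sub (ht.const_mul (5 / 4 : ℝ))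
      |>.add ((ht.pow 3).const_mul (3 / 4 : ℝ))
    refine h.congr_deriv ?_
    have h4 : Real.sqrt 2 ^ 4 = 4 := by
      rw [show 4 = 2 * 2 from rfl, pow_mul, Real.sq_sqrt (by norm_num)]; norm_num
    simp only [A, Q, Real.tanh_eq_sinh_div_cosh, id, Pi.pow_apply, Pi.div_apply]
    push_cast
    field_simp
    rw [h4]
    linear_combination (14 * Real.cosh x ^ 3 - 4 * Real.cosh x
      - 9 * Real.cosh x * (Real.sinh x ^ 2 + Real.cosh x ^ 2 - 1)) * Real.sinh_sq x
  · exact (hA.mul (continuous_Q.pow 3)).intervalIntegrable _ _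

theorem D0_one : D0 1 = fun y => -(Q y / 2) := by
  funext y
  have e3 : ∀ z, Q z ^ (2 * (1 : ℝ) + 1) = Q z ^ 3 := fun z => by
    rw [show 2 * (1 : ℝ) + 1 = (3 : ℕ) by norm_num, Real.rpow_natCast]
  have e4 : Q y ^ (2 * (1 : ℝ) + 2) = Q y ^ 4 := by
    rw [show 2 * (1 : ℝ) + 2 = (4 : ℕ) by norm_num, Real.rpow_natCast]
  have hc := (Real.cosh_pos y).ne'
  have h4 : Real.sqrt 2 ^ 4 = 4 := by
    rw [show 4 = 2 * 2 from rfl, pow_mul, Real.sq_sqrt (by norm_num)]; norm_num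
  simp only [D0, e3, e4, integral_A_mul_Q_cube, deriv_Q]
  simp only [A, Q, Real.tanh_eq_sinh_div_cosh, div_pow, h4]
  field_simp
  linear_combination (12 * Real.cosh y * (Real.sinh y ^ 2 + Real.cosh y ^ 2 - 1)
    + 4 * Real.cosh y - 20 * Real.cosh y ^ 3) * Real.sinh_sq y

theorem T1_one : T1 1 = fun _ => 0 := by
  funext y
  simp [T1]

theorem T2_one : T2 1 = fun _ => 0 := by
  funext y
  simp [T2]

theorem deriv_D0_one (y : ℝ) : deriv (D0 1) y = -(deriv Q y / 2) := by
  rw [D0_one]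
  exact ((hasDerivAt_Q y).differentiableAt.hasDerivAt.div_const 2).neg.deriv

theorem Q_rpow_one (y : ℝ) :
    Q y ^ (2 * (1 : ℝ) - 1) = Q y ∧ Q y ^ (2 * (1 : ℝ) + 1) = Q y ^ 3 ∧
      Q y ^ (2 * (1 : ℝ) + 3) = Q y ^ 5 ∧ Q y ^ (2 * (1 : ℝ) + 5) = Q y ^ 7 := by
  refine ⟨?_, ?_, ?_, ?_⟩
  · rw [show 2 * (1 : ℝ) - 1 = 1 by norm_num, Real.rpow_one]
  · rw [show 2 * (1 : ℝ) + 1 = (3 : ℕ) by norm_num, Real.rpow_natCast]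
  · rw [show 2 * (1 : ℝ) + 3 = (5 : ℕ) by norm_num, Real.rpow_natCast]
  · rw [show 2 * (1 : ℝ) + 5 = (7 : ℕ) by norm_num, Real.rpow_natCast]

theorem Delta4_one (y : ℝ) : Delta4 1 y = 2 * Q y - 3 * Q y ^ 3 + 3 / 2 * Q y ^ 5 := by
  obtain ⟨h1, h3, h5, -⟩ := Q_rpow_one y
  simp only [Delta4, deriv_D0_one]
  simp only [D0_one, T1_one, T2_one, h1, h3, h5, deriv_const]
  linear_combination 4 * Q y * deriv_Q_sq y

theorem Delta5_one (y : ℝ) : Delta5 1 y = 3 * Q y - 4 * Q y ^ 3 + 3 / 2 * Q y ^ 5 := by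
  obtain ⟨h1, h3, h5, h7⟩ := Q_rpow_one y
  simp only [Delta5, deriv_D0_one]
  simp only [D0_one, T1_one, T2_one, h1, h3, h5, h7, deriv_const]
  linear_combination 4 * Q y ^ 3 * deriv_Q_sq y

theorem two_mul_deriv_div_mul_Delta5_one (y : ℝ) :
    2 * deriv Q y / Q y * Delta5 1 y = deriv Q y * (6 - 8 * Q y ^ 2 + 3 * Q y ^ 4) := by
  have hne := (Q_pos y).ne'
  rw [Delta5_one]
  field_simp
  ring

theorem abs_deriv_Q_le (y : ℝ) : |deriv Q y| ≤ Q y :=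
  abs_le_of_sq_le_sq (by rw [deriv_Q_sq]; have := Q_pos y; nlinarith [pow_pos this 4])
    (Q_pos y).le

theorem Q_le_exp (y : ℝ) : Q y ≤ 2 * Real.sqrt 2 * Real.exp (-|y|) := by
  have h : Real.exp |y| ≤ 2 * Real.cosh y := by
    rw [← Real.cosh_abs, Real.cosh_eq]
    linarith [Real.exp_pos (-|y|)]
  rw [Q, Real.exp_neg, ← div_eq_mul_inv, div_le_div_iff₀ (Real.cosh_pos y) (Real.exp_pos _)]
  nlinarith [Real.sqrt_nonneg 2]

theorem integrable_Q : Integrable Q := by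
  have h : Integrable fun y : ℝ => 2 * Real.sqrt 2 * Real.exp (-|y|) := by
    refine Integrable.const_mul ?_ _
    refine Integrable.of_integral_ne_zero ?_
    rw [integral_comp_abs (f := fun x => Real.exp (-x)), integral_exp_neg_Ioi_zero]
    norm_num
  refine h.mono' continuous_Q.aestronglyMeasurable (Filter.Eventually.of_forall fun y => ?_)
  rw [Real.norm_of_nonneg (Q_pos y).le]
  exact Q_le_exp y

theorem tendsto_Q_cocompact : Filter.Tendsto Q (Filter.cocompact ℝ) (nhds 0) := by
  refine squeeze_zero (fun y => (Q_pos y).le) Q_le_exp ?_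
  have h := (Real.tendsto_exp_neg_atTop_nhds_zero.comp
    (tendsto_norm_cocompact_atTop (E := ℝ))).const_mul (2 * Real.sqrt 2)
  simpa [Function.comp_def] using h

/-- An antiderivative of the integrand defining `Gamma0 1`. -/
noncomputable def gammaPrimitive (y : ℝ) : ℝ :=
  (3 * Q y - 5 / 2 * Q y ^ 3 + 1 / 2 * Q y ^ 5) * Real.sin y
    + deriv Q y * (-3 + 1 / 2 * Q y ^ 2 - 1 / 2 * Q y ^ 4) * Real.cos y

theorem hasDerivAt_gammaPrimitive (y : ℝ) :
    HasDerivAt gammaPrimitive (Q y ^ 2 * Delta4 1 y * Real.cos y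
      + (2 * deriv Q y / Q y) * Delta5 1 y * Real.sin y) y := by
  have hQ := (hasDerivAt_Q y).differentiableAt.hasDerivAt
  have h := ((((hQ.const_mul 3).sub ((hQ.pow 3).const_mul (5 / 2))).add
      ((hQ.pow 5).const_mul (1 / 2))).mul (Real.hasDerivAt_sin y)).add
    (((hasDerivAt_deriv_Q y).mul ((((hQ.pow 2).const_mul (1 / 2)).const_add (-3)).sub
      ((hQ.pow 4).const_mul (1 / 2)))).mul (Real.hasDerivAt_cos y))
  refine h.congr_deriv ?_
  rw [two_mul_deriv_div_mul_Delta5_one, Delta4_one]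
  simp
  linear_combination (Q y - 2 * Q y ^ 3) * Real.cos y * deriv_Q_sq y

theorem abs_mul_add_mul_le {a b c d M q : ℝ} (ha : |a| ≤ M * q) (hb : |b| ≤ M * q) (hc : |c| ≤ 1)
    (hd : |d| ≤ 1) : |a * c + b * d| ≤ 2 * M * q := by
  have h1 : |a * c| ≤ M * q := by
    rw [abs_mul]; exact (mul_le_of_le_one_right (abs_nonneg a) hc).trans ha
  have h2 : |b * d| ≤ M * q := by
    rw [abs_mul]; exact (mul_le_of_le_one_right (abs_nonneg b) hd).trans hb
  linarith [abs_add_le (a * c) (b * d)]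

theorem Q_sq_le (y : ℝ) : Q y ^ 2 ≤ 2 := by
  have h := pow_le_pow_left₀ (Q_pos y).le (Q_le y) 2
  rwa [Real.sq_sqrt (by norm_num)] at h

theorem abs_gammaPrimitive_le (y : ℝ) : |gammaPrimitive y| ≤ 2 * 10 * Q y := by
  have hQ := Q_pos y
  have h2 := Q_sq_le y
  have h0 := sq_nonneg (Q y)
  have h4 : Q y ^ 4 ≤ 4 := by nlinarith
  refine abs_mul_add_mul_le ?_ ?_ (Real.abs_sin_le_one y) (Real.abs_cos_le_one y)
  · rw [show 3 * Q y - 5 / 2 * Q y ^ 3 + 1 / 2 * Q y ^ 5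
        = (3 - 5 / 2 * Q y ^ 2 + 1 / 2 * Q y ^ 4) * Q y by ring, abs_mul, abs_of_pos hQ]
    gcongr
    rw [abs_le]
    constructor <;> nlinarith
  · rw [abs_mul, mul_comm]
    gcongr
    · rw [abs_le]
      constructor <;> nlinarith
    · exact abs_deriv_Q_le y

theorem abs_gamma_integrand_le (y : ℝ) :
    |Q y ^ 2 * Delta4 1 y * Real.cos y + (2 * deriv Q y / Q y) * Delta5 1 y * Real.sin y|
      ≤ 2 * 34 * Q y := by
  have hQ := Q_pos y
  have h2 := Q_sq_le y
  have h0 := sq_nonneg (Q y)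
  have h4 : Q y ^ 4 ≤ 4 := by nlinarith
  have h6 : Q y ^ 6 ≤ 8 := by nlinarith
  refine abs_mul_add_mul_le ?_ ?_ (Real.abs_cos_le_one y) (Real.abs_sin_le_one y)
  · rw [Delta4_one, show Q y ^ 2 * (2 * Q y - 3 * Q y ^ 3 + 3 / 2 * Q y ^ 5)
        = (2 * Q y ^ 2 - 3 * Q y ^ 4 + 3 / 2 * Q y ^ 6) * Q y by ring, abs_mul, abs_of_pos hQ]
    gcongr
    rw [abs_le]
    constructor <;> nlinarith
  · rw [two_mul_deriv_div_mul_Delta5_one, abs_mul, mul_comm]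
    gcongr
    · rw [abs_le]
      constructor <;> nlinarith
    · exact abs_deriv_Q_le y

theorem tendsto_gammaPrimitive_cocompact :
    Filter.Tendsto gammaPrimitive (Filter.cocompact ℝ) (nhds 0) := by
  refine squeeze_zero_norm abs_gammaPrimitive_le ?_
  simpa using tendsto_Q_cocompact.const_mul (2 * 10)

theorem integrable_gamma_integrand :
    Integrable fun y => Q y ^ 2 * Delta4 1 y * Real.cos y
      + (2 * deriv Q y / Q y) * Delta5 1 y * Real.sin y := by
  refine (integrable_Q.const_mul (2 * 34)).mono' ?_
    (Filter.Eventually.of_forall abs_gamma_integrand_le)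
  have hd : Continuous (deriv Q) :=
    continuous_iff_continuousAt.2 fun y => (hasDerivAt_deriv_Q y).continuousAt
  have hQ := continuous_Q
  simp only [two_mul_deriv_div_mul_Delta5_one, Delta4_one]
  exact Continuous.aestronglyMeasurable (by fun_prop)

theorem stmt17 : Gamma0 1 = 0 := by
  rw [Gamma0, integral_of_hasDerivAt_of_tendsto hasDerivAt_gammaPrimitive
    integrable_gamma_integrand (tendsto_gammaPrimitive_cocompact.mono_left atBot_le_cocompact)
    (tendsto_gammaPrimitive_cocompact.mono_left atTop_le_cocompact), sub_zero]
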